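/- Constituent replacement theorem. Let X be a multi-filtered complex, and suppose that for each v ∈ ℤ^m with some X_{n,v} ≠ 0 we are given a cochain complex B_v of R-modules with only finitely many nonzero terms and a homotopy equivalence between B_v and the constituent complex X_v (take B_v = 0 for all other v). Then there exists a multi-filtered complex Y with Y_{n,v} = (B_v)_n, whose diagonal differential components d^Y_{•;v,v} are the given differentials of B_v, and which is filtered homotopy equivalent to X. -/

import Mathlib

open CategoryTheory CategoryTheory.Limits

noncomputable section

/-- Index vectors in `ℤ^m`, partially ordered componentwise. -/
abbrev Idx (m : ℕ) : Type := Fin m → ℤ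

/-- The total degree `|v| = v₁ + ⋯ + v_m` of an index vector. -/
def tdeg {m : ℕ} (v : Idx m) : ℤ := ∑ i, v i

/-- A multi-filtered complex of `R`-modules: a family of modules `X n v` (`n ∈ ℤ` the
homological degree, `v ∈ ℤ^m` the multi-filtration index), all but finitely many trivial,
with differential components `d n v v' : X n v ⟶ X (n+1) v'` vanishing unless `v ≤ v'`,
such that the total differential squares to zero (componentwise). -/
structure MFC (m : ℕ) (R : Type) [CommRing R] where
  X : ℤ → Idx m → ModuleCat.{0} R
  d : ∀ (n : ℤ) (v v' : Idx m), X n v ⟶ X (n + 1) v'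
  d_supp : ∀ n v v', ¬ v ≤ v' → d n v v' = 0
  fin : {p : ℤ × Idx m | ¬ Subsingleton (X p.1 p.2)}.Finite
  dsq : ∀ (n : ℤ) (v v'' : Idx m), (∑ᶠ v', d n v v' ≫ d (n + 1) v' v'') = 0

variable {m : ℕ} {R : Type} [CommRing R]

/-- A degree-`0` filtered morphism of multi-filtered complexes: components
`f n v v' : X n v ⟶ Y n v'` vanishing unless `v ≤ v'`, commuting with the total
differentials (componentwise). -/
structure MFCHom (C D : MFC m R) where
  f : ∀ (n : ℤ) (v v' : Idx m), C.X n v ⟶ D.X n v'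
  supp : ∀ n v v', ¬ v ≤ v' → f n v v' = 0
  comm : ∀ (n : ℤ) (v v'' : Idx m),
    (∑ᶠ v', C.d n v v' ≫ f (n + 1) v' v'') = (∑ᶠ v', f n v v' ≫ D.d n v' v'')

/-- The `(v,v')`-component of the identity morphism of a multi-filtered complex. -/
def idComp (C : MFC m R) (n : ℤ) (v v' : Idx m) : C.X n v ⟶ C.X n v' :=
  if h : v = v' then eqToHom (by rw [h]) else 0

/-- A filtered homotopy equivalence between multi-filtered complexes: filtered morphisms
`f`, `g` in both directions together with filtered homotopies (of homological degree `-1`)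
between `g ∘ f` resp. `f ∘ g` and the identities. -/
structure MFCHomotopyEquiv (C D : MFC m R) where
  toFun : MFCHom C D
  invFun : MFCHom D C
  hC : ∀ (n : ℤ) (v v' : Idx m), C.X (n + 1) v ⟶ C.X n v'
  hC_supp : ∀ n v v', ¬ v ≤ v' → hC n v v' = 0
  hD : ∀ (n : ℤ) (v v' : Idx m), D.X (n + 1) v ⟶ D.X n v'
  hD_supp : ∀ n v v', ¬ v ≤ v' → hD n v v' = 0
  homC : ∀ (n : ℤ) (v v'' : Idx m),
    (∑ᶠ v', toFun.f n v v' ≫ invFun.f n v' v'') - idComp C n v v''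
      = (∑ᶠ v', (eqToHom (show C.X n v = C.X (n - 1 + 1) v by rw [Int.sub_add_cancel])
            ≫ hC (n - 1) v v') ≫ C.d (n - 1) v' v''
            ≫ eqToHom (show C.X (n - 1 + 1) v'' = C.X n v'' by rw [Int.sub_add_cancel]))
        + (∑ᶠ v', C.d n v v' ≫ hC n v' v'')
  homD : ∀ (n : ℤ) (v v'' : Idx m),
    (∑ᶠ v', invFun.f n v v' ≫ toFun.f n v' v'') - idComp D n v v''
      = (∑ᶠ v', (eqToHom (show D.X n v = D.X (n - 1 + 1) v by rw [Int.sub_add_cancel])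
            ≫ hD (n - 1) v v') ≫ D.d (n - 1) v' v''
            ≫ eqToHom (show D.X (n - 1 + 1) v'' = D.X n v'' by rw [Int.sub_add_cancel]))
        + (∑ᶠ v', D.d n v v' ≫ hD n v' v'')

/-- The constituent complex `X_v = (X_{•,v}, d_{•;v,v})` of a multi-filtered complex. -/
def constituent (C : MFC m R) (v : Idx m) : CochainComplex (ModuleCat.{0} R) ℤ :=
  CochainComplex.of (fun n => C.X n v) (fun n => C.d n v v) (by
    intro n
    have h := C.dsq n v v
    rw [finsum_eq_single _ v (fun v' hv' => ?_)] at h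
    · exact h
    · by_cases h1 : v ≤ v'
      · have h2 : ¬ v' ≤ v := fun hle => hv' (le_antisymm hle h1)
        rw [C.d_supp _ _ _ h2, comp_zero]
      · rw [C.d_supp _ _ _ h1, zero_comp])

theorem pert_ring {S : Type*} [Ring S] (d0 δ h f0 g0 b0 e U : S)
    (hU1 : (1 - δ * h) * U = 1) (hU2 : U * (1 - δ * h) = 1)
    (hδ : d0 * δ + δ * d0 + δ * δ = 0) (hb0 : b0 * b0 = 0)
    (hf0 : f0 * d0 = b0 * f0) (hg0 : d0 * g0 = g0 * b0)
    (hgf : g0 * f0 - e = d0 * h + h * d0) (eδ : e * δ = δ) (δe : δ * e = δ) :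
    (b0 + f0 * U * δ * g0) * (b0 + f0 * U * δ * g0) = 0 ∧
    (f0 * U) * (d0 + δ) = (b0 + f0 * U * δ * g0) * (f0 * U) ∧
    (d0 + δ) * (g0 + h * U * δ * g0) = (g0 + h * U * δ * g0) * (b0 + f0 * U * δ * g0) ∧
    (g0 + h * U * δ * g0) * (f0 * U) - e = (d0 + δ) * (h * U) + (h * U) * (d0 + δ) := by
  have hgf' : g0 * f0 = e + d0 * h + h * d0 := by
    rw [add_assoc, ← hgf]; abel
  set V : S := 1 + h * U * δ with hV
  have hV1 : (1 - h * δ) * V = 1 := by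
    linear_combination (norm := (rw [hV]; noncomm_ring)) h * hU1 * δ
  have hV2 : V * (1 - h * δ) = 1 := by
    linear_combination (norm := (rw [hV]; noncomm_ring)) h * hU2 * δ
  have hUV : U * δ = δ * V := by
    linear_combination (norm := (rw [hV]; noncomm_ring)) (hU1 * δ)
  have hVh : h * U = V * h := by
    linear_combination (norm := (rw [hV]; noncomm_ring)) (h * hU2)
  have hg : g0 + h * U * δ * g0 = V * g0 := by rw [hV]; noncomm_ring
  have hd : δ * d0 = - (d0 * δ) - δ * δ := by
    linear_combination (norm := noncomm_ring) hδ
  -- cancellation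
  have canL : ∀ x y : S, (1 - h * δ) * x = (1 - h * δ) * y → x = y := by
    intro x y hxy
    have := congrArg (V * ·) hxy
    simpa only [← mul_assoc, hV2, one_mul] using this
  have canL' : ∀ x y : S, (1 - δ * h) * x = (1 - δ * h) * y → x = y := by
    intro x y hxy
    have := congrArg (U * ·) hxy
    simpa only [← mul_assoc, hU2, one_mul] using this
  have canR : ∀ x y : S, x * (1 - δ * h) = y * (1 - δ * h) → x = y := by
    intro x y hxy
    have := congrArg (· * U) hxy
    simpa only [mul_assoc, hU1, mul_one] using this
  have canR' : ∀ x y : S, x * (1 - h * δ) = y * (1 - h * δ) → x = y := by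
    intro x y hxy
    have := congrArg (· * V) hxy
    simpa only [mul_assoc, hV1, mul_one] using this
  have k1 : d0 * (U * δ) + U * δ * d0 + U * δ * (e + d0 * h + h * d0) * (U * δ) = 0 := by
    apply canL'
    apply canR'
    have e1 : (1 - δ * h) * (d0 * (U * δ) + U * δ * d0 + U * δ * (e + d0 * h + h * d0) * (U * δ)) * (1 - h * δ)
      = (1 - δ * h) * d0 * δ * (V * (1 - h * δ)) + ((1 - δ * h) * U) * δ * d0 * (1 - h * δ)
        + ((1 - δ * h) * U) * δ * (e + d0 * h + h * d0) * δ * (V * (1 - h * δ)) := by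
      linear_combination (norm := noncomm_ring) (1 - δ * h) * d0 * hUV * (1 - h * δ) +
        (1 - δ * h) * U * δ * (e + d0 * h + h * d0) * hUV * (1 - h * δ)
    rw [e1, hU1, hV2]
    linear_combination (norm := noncomm_ring) hδ + δ * eδ
  have k2 : U * (d0 + δ) = (d0 + U * δ * (e + d0 * h + h * d0)) * U := by
    apply canL'
    apply canR
    have e1 : (1 - δ * h) * (U * (d0 + δ)) * (1 - δ * h) = ((1 - δ * h) * U) * (d0 + δ) * (1 - δ * h) := by
      noncomm_ring
    have e2 : (1 - δ * h) * ((d0 + U * δ * (e + d0 * h + h * d0)) * U) * (1 - δ * h) =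
      ((1 - δ * h) * d0 + ((1 - δ * h) * U) * δ * (e + d0 * h + h * d0)) * (U * (1 - δ * h)) := by
      noncomm_ring
    rw [e1, e2, hU1, hU2]
    linear_combination (norm := noncomm_ring) - (hδ * h) - δe
  have k3 : (d0 + δ) * V = V * (d0 + (e + d0 * h + h * d0) * (δ * V)) := by
    apply canL
    apply canR'
    have e1 : (1 - h * δ) * ((d0 + δ) * V) * (1 - h * δ) = (1 - h * δ) * (d0 + δ) * (V * (1 - h * δ)) := by
      noncomm_ring
    have e2 : (1 - h * δ) * (V * (d0 + (e + d0 * h + h * d0) * (δ * V))) * (1 - h * δ) =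
      ((1 - h * δ) * V) * (d0 * (1 - h * δ) + (e + d0 * h + h * d0) * δ * (V * (1 - h * δ))) := by
      noncomm_ring
    rw [e1, e2, hV1, hV2]
    linear_combination (norm := noncomm_ring) - (h * hδ) - eδ
  have k4 : V * (e + d0 * h + h * d0) * U - e = (d0 + δ) * (h * U) + (h * U) * (d0 + δ) := by
    apply canL
    apply canR
    have e1 : (1 - h * δ) * (V * (e + d0 * h + h * d0) * U - e) * (1 - δ * h) =
      ((1 - h * δ) * V) * (e + d0 * h + h * d0) * (U * (1 - δ * h)) - (1 - h * δ) * e * (1 - δ * h) := by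
      noncomm_ring
    have e2 : (1 - h * δ) * ((d0 + δ) * (h * U) + (h * U) * (d0 + δ)) * (1 - δ * h) =
      (1 - h * δ) * (d0 + δ) * h * (U * (1 - δ * h)) + ((1 - h * δ) * (h * U)) * (d0 + δ) * (1 - δ * h) := by
      noncomm_ring
    have e3 : (1 - h * δ) * (h * U) = h := by
      rw [hVh, ← mul_assoc, hV1, one_mul]
    rw [e1, e2, e3, hV1, hU2]
    linear_combination (norm := noncomm_ring) h * hδ * h + h * δe + eδ * h - h * δ * eδ * h
  refine ⟨?_, ?_, ?_, ?_⟩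
  · linear_combination (norm := noncomm_ring) hb0 - hf0 * U * δ * g0 - f0 * U * δ * hg0 + f0 * U * δ * hgf' * U * δ * g0 + f0 * k1 * g0
  · linear_combination (norm := noncomm_ring) f0 * k2 - f0 * U * δ * hgf' * U + hf0 * U
  · rw [hg]
    linear_combination (norm := noncomm_ring) k3 * g0 - V * hgf' * U * δ * g0 + V * hg0 - V * (e + d0 * h + h * d0) * hUV * g0
  · rw [hg]
    linear_combination (norm := noncomm_ring) k4 + V * hgf' * U

theorem pert_ring2 {S : Type*} [Ring S] (d b f g H k e' P : S)
    (hfd : f * d = b * f) (hgd : d * g = g * b) (hb : b * b = 0)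
    (heb : e' * b = b) (hbe : b * e' = b) (hee : e' * e' = e')
    (hef : e' * f = f) (hge : g * e' = g) (hek : e' * k = k) (hke : k * e' = k) (e : S)
    (hfe : f * e = f) (hH : g * f - e = d * H + H * d)
    (N : S) (hN : N = f * g - e' - (b * k + k * b))
    (hP1 : (1 + N) * (1 + P) = 1) (hP2 : (1 + P) * (1 + N) = 1) (K : S)
    (hK : K = k + (1 + P) * (f * H * g - f * g * k - k * f * g + k * (b * k + k * b) + k)) :
    f * g - e' = b * K + K * b := by
  have hNb : N * b = b * N := by
    rw [hN]
    linear_combination (norm := noncomm_ring) hfd * g - f * hgd + hbe - heb - k * hb + hb * k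
  have hPb : (1 + P) * b = b * (1 + P) := by
    have : (1 + P) * (b * (1 + N)) * (1 + P) = (1 + P) * ((1 + N) * b) * (1 + P) := by
      congr 2; linear_combination (norm := noncomm_ring) - hNb
    linear_combination (norm := noncomm_ring) this - (1 + P) * b * hP1 + hP2 * b * (1 + P)
  have hNe : N * e' = N := by
    rw [hN]
    linear_combination (norm := noncomm_ring) f * hge - hee - b * hke - k * hbe
  set W : S := f * H * g - f * g * k - k * f * g + k * (b * k + k * b) + k with hW
  have heN : e' * N = N := by
    rw [hN]
    linear_combination (norm := noncomm_ring) hef * g - hee - heb * k - hek * b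
  have hfgb : b * (f * g) = f * g * b := by
    linear_combination (norm := noncomm_ring) - (hfd * g) + f * hgd
  have hc0 : e' + N = f * g - (b * k + k * b) := by rw [hN]; noncomm_ring
  have hc1 : N + N * N = (e' + N) * (e' + N) - (e' + N) := by
    linear_combination (norm := noncomm_ring) - heN - hNe - hee
  have hc : N + N * N = b * W + W * b := by
    rw [hc1, hc0, hW]
    linear_combination (norm := noncomm_ring) f * hH * g + hfe * g + hfd * H * g + f * H * hgd
      + hfgb * k - k * hfgb + k * hb * k - k * k * hb
  have hN2 : N = (1 + P) * (N + N * N) := by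
    linear_combination (norm := noncomm_ring) - (hP2 * N)
  have h3 : f * g - e' = N + (b * k + k * b) := by rw [hN]; noncomm_ring
  rw [h3, hK]
  linear_combination (norm := noncomm_ring) hN2 + (1 + P) * hc + hPb * W

namespace CR

/-! ### Matrices of module maps as endomorphisms of a product -/

section Mat

variable {R : Type} [CommRing R] {I : Type} (M : I → ModuleCat.{0} R)

/-- The product of all the modules in the family. -/
abbrev Tot : Type := ∀ p, M p

variable {M}

open Classical in
/-- The `(p,q)` component of an endomorphism of the total module. -/
def cmp (a : Module.End R (Tot M)) (p q : I) : M p ⟶ M q :=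
  ModuleCat.ofHom (LinearMap.proj q ∘ₗ a ∘ₗ LinearMap.single R (fun p => M p) p)

/-- The endomorphism with given components. -/
def mkE (F : Finset I) (c : ∀ p q, M p ⟶ M q) : Module.End R (Tot M) :=
  LinearMap.pi (fun q => ∑ p ∈ F, (c p q).hom ∘ₗ LinearMap.proj p)

theorem cmp_add (a b : Module.End R (Tot M)) (p q : I) :
    cmp (a + b) p q = cmp a p q + cmp b p q := by
  ext x; simp [cmp]

theorem cmp_sub (a b : Module.End R (Tot M)) (p q : I) :
    cmp (a - b) p q = cmp a p q - cmp b p q := by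
  ext x; simp [cmp]

theorem cmp_neg (a : Module.End R (Tot M)) (p q : I) :
    cmp (-a) p q = - cmp a p q := by
  ext x; simp [cmp]

theorem cmp_zero (p q : I) : cmp (0 : Module.End R (Tot M)) p q = 0 := by
  ext x; simp [cmp]

theorem hom_src {A B : ModuleCat.{0} R} (h : Subsingleton A) (f g : A ⟶ B) : f = g := by
  ext x
  rw [Subsingleton.elim x 0, map_zero, map_zero]

theorem hom_tgt {A B : ModuleCat.{0} R} (h : Subsingleton B) (f g : A ⟶ B) : f = g := by
  ext x
  exact Subsingleton.elim _ _

open Classical in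
theorem cmp_mkE (F : Finset I) (hF : ∀ p, p ∉ F → Subsingleton (M p))
    (c : ∀ p q, M p ⟶ M q) (p q : I) : cmp (mkE F c) p q = c p q := by
  by_cases hp : p ∈ F
  · ext x
    simp only [cmp, mkE, ModuleCat.hom_ofHom, LinearMap.comp_apply, LinearMap.proj_apply,
      LinearMap.pi_apply, LinearMap.sum_apply, LinearMap.single_apply]
    rw [Finset.sum_eq_single p]
    · simp
    · intro r _ hr
      rw [Pi.single_eq_of_ne hr, map_zero]
    · intro h; exact absurd hp h
  · exact hom_src (hF p hp) _ _

open Classical in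
theorem tot_decomp (F : Finset I) (hF : ∀ p, p ∉ F → Subsingleton (M p)) (x : Tot M) :
    x = ∑ r ∈ F, Pi.single r (x r) := by
  funext q
  rw [Finset.sum_apply]
  by_cases hq : q ∈ F
  · rw [Finset.sum_eq_single q]
    · simp
    · intro r _ hr
      rw [Pi.single_eq_of_ne (Ne.symm hr)]
    · intro h; exact absurd hq h
  · exact @Subsingleton.elim _ (hF q hq) _ _

open Classical in
theorem cmp_ext (F : Finset I) (hF : ∀ p, p ∉ F → Subsingleton (M p))
    {a b : Module.End R (Tot M)} (h : ∀ p q, cmp a p q = cmp b p q) : a = b := by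
  apply LinearMap.ext
  intro x
  rw [tot_decomp F hF x, map_sum, map_sum]
  refine Finset.sum_congr rfl fun p _ => ?_
  funext q
  have := congrArg (fun φ => φ.hom (x p)) (h p q)
  simpa [cmp] using this

open Classical in
theorem cmp_mul (F : Finset I) (hF : ∀ p, p ∉ F → Subsingleton (M p))
    (a b : Module.End R (Tot M)) (p q : I) :
    cmp (b * a) p q = ∑ᶠ r, cmp a p r ≫ cmp b r q := by
  rw [finsum_eq_finsetSum_of_support_subset (s := F)]
  · ext x
    simp only [cmp, ModuleCat.hom_ofHom, LinearMap.comp_apply, LinearMap.proj_apply,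
      LinearMap.single_apply, ModuleCat.hom_sum, LinearMap.sum_apply, ModuleCat.hom_comp,
      Module.End.mul_apply]
    conv_lhs => rw [tot_decomp F hF (a (Pi.single p x)), map_sum, Finset.sum_apply]
  · intro r hr
    by_contra hrF
    apply hr
    show cmp a p r ≫ cmp b r q = 0
    rw [hom_src (hF r hrF) (cmp b r q) 0, comp_zero]

theorem finsum_inj {J A : Type*} [AddCommMonoid A] (g : J → I) (hg : Function.Injective g)
    (f : I → A) (hf : ∀ i, i ∉ Set.range g → f i = 0) : ∑ᶠ i, f i = ∑ᶠ j, f (g j) := by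
  rw [← finsum_mem_range hg]
  refine finsum_congr fun i => ?_
  by_cases hi : i ∈ Set.range g
  · simp [hi]
  · simp [hi, hf i hi]

end Mat

section Graded

variable {m : ℕ} {R : Type} [CommRing R] {M : Bool × ℤ × Idx m → ModuleCat.{0} R}

/-- Condition for a component to be allowed to be nonzero. -/
def Ok (s t : Bool) (k j : ℤ) (p q : Bool × ℤ × Idx m) : Prop :=
  p.1 = s ∧ q.1 = t ∧ q.2.1 = p.2.1 + k ∧ p.2.2 ≤ q.2.2 ∧ tdeg p.2.2 + j ≤ tdeg q.2.2

variable (M) in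
/-- Filtered maps of degree `k`, raising the total filtration degree by at least `j`. -/
def G (s t : Bool) (k j : ℤ) : AddSubgroup (Module.End R (Tot M)) where
  carrier := {a | ∀ p q, ¬ Ok s t k j p q → cmp a p q = 0}
  zero_mem' := fun p q _ => cmp_zero p q
  add_mem' := fun {a b} ha hb p q h => by rw [cmp_add, ha p q h, hb p q h, add_zero]
  neg_mem' := fun {a} ha p q h => by rw [cmp_neg, ha p q h, neg_zero]

theorem G_mono {s t : Bool} {k j j' : ℤ} (hj : j' ≤ j) {a : Module.End R (Tot M)}
    (ha : a ∈ G M s t k j) : a ∈ G M s t k j' := by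
  intro p q h
  apply ha
  rintro ⟨h1, h2, h3, h4, h5⟩
  exact h ⟨h1, h2, h3, h4, by omega⟩

theorem G_mul (F : Finset (Bool × ℤ × Idx m)) (hF : ∀ p, p ∉ F → Subsingleton (M p))
    {s t u : Bool} {k j k' j' k'' j'' : ℤ} {a b : Module.End R (Tot M)}
    (hb : b ∈ G M t u k' j') (ha : a ∈ G M s t k j) (hk : k + k' = k'') (hj : j'' ≤ j + j') :
    b * a ∈ G M s u k'' j'' := by
  intro p q h
  rw [cmp_mul F hF]
  apply finsum_eq_zero_of_forall_eq_zero
  intro r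
  by_cases h1 : Ok s t k j p r
  · by_cases h2 : Ok t u k' j' r q
    · exfalso
      obtain ⟨a1, a2, a3, a4, a5⟩ := h1
      obtain ⟨b1, b2, b3, b4, b5⟩ := h2
      exact h ⟨a1, b2, by omega, a4.trans b4, by omega⟩
    · rw [hb r q h2, comp_zero]
  · rw [ha p r h1, zero_comp]

theorem cmp_mul_G (F : Finset (Bool × ℤ × Idx m)) (hF : ∀ p, p ∉ F → Subsingleton (M p))
    {s t : Bool} {k j : ℤ} {a b : Module.End R (Tot M)}
    (ha : a ∈ G M s t k j) (n n' : ℤ) (hn : n' = n + k) (v : Idx m)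
    (q : Bool × ℤ × Idx m) :
    cmp (b * a) (s, n, v) q = ∑ᶠ v', cmp a (s, n, v) (t, n', v') ≫ cmp b (t, n', v') q := by
  rw [cmp_mul F hF]
  refine finsum_inj (fun v' : Idx m => ((t, n', v') : Bool × ℤ × Idx m)) ?_ _ ?_
  · intro x y h; simpa using h
  · rintro ⟨t1, n1, v1⟩ hi
    rw [ha, zero_comp]
    rintro ⟨a1, a2, a3, a4, a5⟩
    apply hi
    refine ⟨v1, ?_⟩
    simp only at a2 a3
    simp [a2, a3, hn]

theorem bdd {I : Type} (F : Finset I) (w : I → ℤ) : ∃ L : ℤ, ∀ p ∈ F, |w p| ≤ L :=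
  ⟨∑ p ∈ F, |w p|, fun p hp =>
    Finset.single_le_sum (f := fun p => |w p|) (fun _ _ => abs_nonneg _) hp⟩

theorem G_nil (F : Finset (Bool × ℤ × Idx m)) (hF : ∀ p, p ∉ F → Subsingleton (M p)) :
    ∃ N : ℕ, ∀ (s t : Bool) (k : ℤ) (a : Module.End R (Tot M)),
    a ∈ G M s t k N → a = 0 := by
  obtain ⟨L, hL⟩ := bdd F (fun p => tdeg p.2.2)
  refine ⟨(2 * L + 1).toNat, fun s t k a ha => ?_⟩
  apply cmp_ext F hF
  intro p q
  rw [cmp_zero]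
  by_cases hp : p ∈ F
  · by_cases hq : q ∈ F
    · apply ha
      rintro ⟨a1, a2, a3, a4, a5⟩
      have h1 := abs_le.1 (hL p hp)
      have h2 := abs_le.1 (hL q hq)
      have h3 := Int.self_le_toNat (2 * L + 1)
      linarith [h1.1, h2.2]
    · exact hom_tgt (hF q hq) _ _
  · exact hom_src (hF p hp) _ _

theorem G_inv (F : Finset (Bool × ℤ × Idx m)) (hF : ∀ p, p ∉ F → Subsingleton (M p))
    {s : Bool} {x : Module.End R (Tot M)} (hx : x ∈ G M s s 0 1) :
    ∃ P ∈ G M s s 0 1, (1 - x) * (1 + P) = 1 ∧ (1 + P) * (1 - x) = 1 := by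
  obtain ⟨N, hN⟩ := G_nil F hF
  have hpow : ∀ i : ℕ, x ^ (i + 1) ∈ G M s s 0 ((i + 1 : ℕ) : ℤ) := by
    intro i
    induction i with
    | zero => simpa using hx
    | succ i ih =>
      rw [pow_succ]
      exact G_mul F hF ih hx (by simp) (by push_cast; omega)
  have hz : x ^ (N + 1) = 0 := by
    apply hN s s 0
    exact G_mono (by push_cast; omega) (hpow N)
  have h1 : 1 + ∑ i ∈ Finset.range N, x ^ (i + 1) = ∑ i ∈ Finset.range (N + 1), x ^ i := by
    rw [Finset.sum_range_succ', pow_zero, add_comm]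
  refine ⟨∑ i ∈ Finset.range N, x ^ (i + 1), ?_, ?_, ?_⟩
  · exact sum_mem fun i _ => G_mono (by push_cast; omega) (hpow i)
  · rw [h1, mul_neg_geom_sum, hz, sub_zero]
  · rw [h1, geom_sum_mul_neg, hz, sub_zero]

open Classical in
variable (M) in
/-- Diagonal (in the filtration index) operators. -/
def dg (s t : Bool) (φ : ∀ (v : Idx m) (n n' : ℤ), M (s, n, v) ⟶ M (t, n', v)) :
    ∀ p q, M p ⟶ M q := fun p q =>
  if h : p.1 = s ∧ q.1 = t ∧ p.2.2 = q.2.2 then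
    eqToHom (by rw [← h.1]) ≫ φ p.2.2 p.2.1 q.2.1 ≫ eqToHom (by rw [h.2.2, ← h.2.1])
  else 0

theorem dg_self (s t : Bool) (φ : ∀ (v : Idx m) (n n' : ℤ), M (s, n, v) ⟶ M (t, n', v))
    (v : Idx m) (n n' : ℤ) : dg M s t φ (s, n, v) (t, n', v) = φ v n n' := by
  simp [dg]

theorem dg_ne (s t : Bool) (φ : ∀ (v : Idx m) (n n' : ℤ), M (s, n, v) ⟶ M (t, n', v))
    (p q : Bool × ℤ × Idx m) (h : ¬ (p.1 = s ∧ q.1 = t ∧ p.2.2 = q.2.2)) :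
    dg M s t φ p q = 0 := by
  rw [dg, dif_neg h]

variable (M) in
/-- Diagonal operator as an endomorphism. -/
def DD (F : Finset (Bool × ℤ × Idx m)) (s t : Bool)
    (φ : ∀ (v : Idx m) (n n' : ℤ), M (s, n, v) ⟶ M (t, n', v)) : Module.End R (Tot M) :=
  mkE F (dg M s t φ)

section DDsec

variable (F : Finset (Bool × ℤ × Idx m))

theorem DD_mem (hF : ∀ p, p ∉ F → Subsingleton (M p)) (s t : Bool)
    (φ : ∀ (v : Idx m) (n n' : ℤ), M (s, n, v) ⟶ M (t, n', v)) (k : ℤ)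
    (hφ : ∀ v n n', n' ≠ n + k → φ v n n' = 0) : DD M F s t φ ∈ G M s t k 0 := by
  rintro ⟨s1, n, v⟩ ⟨t1, n', v'⟩ h
  rw [DD, cmp_mkE F hF]
  by_cases h1 : s1 = s ∧ t1 = t ∧ v = v'
  · obtain ⟨rfl, rfl, rfl⟩ := h1
    rw [dg_self]
    apply hφ
    intro h2
    exact h ⟨rfl, rfl, h2, le_refl _, by simp⟩
  · exact dg_ne _ _ _ _ _ h1

theorem DD_mul (hF : ∀ p, p ∉ F → Subsingleton (M p)) (s t u : Bool)
    (φ : ∀ (v : Idx m) (n n' : ℤ), M (s, n, v) ⟶ M (t, n', v))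
    (ψ : ∀ (v : Idx m) (n n' : ℤ), M (t, n, v) ⟶ M (u, n', v)) (κ : ℤ → ℤ)
    (hφ : ∀ v n n', n' ≠ κ n → φ v n n' = 0) :
    DD M F t u ψ * DD M F s t φ = DD M F s u (fun v n n' => φ v n (κ n) ≫ ψ v (κ n) n') := by
  apply cmp_ext F hF
  rintro ⟨s1, n, v⟩ ⟨u1, n', v'⟩
  rw [cmp_mul F hF]
  simp only [DD, cmp_mkE F hF]
  by_cases h1 : s1 = s ∧ u1 = u ∧ v = v'
  · obtain ⟨rfl, rfl, rfl⟩ := h1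
    rw [dg_self, finsum_eq_single _ (t, κ n, v), dg_self, dg_self]
    rintro ⟨t1, n1, v1⟩ hr
    by_cases h2 : t1 = t ∧ v = v1
    · obtain ⟨rfl, rfl⟩ := h2
      rw [dg_self, hφ, zero_comp]
      rintro rfl
      exact hr rfl
    · rw [dg_ne, zero_comp]
      rintro ⟨-, h3, h4⟩
      exact h2 ⟨h3, h4⟩
  · rw [dg_ne _ _ _ _ _ h1]
    apply finsum_eq_zero_of_forall_eq_zero
    rintro ⟨t1, n1, v1⟩
    by_cases h2 : s1 = s ∧ t1 = t ∧ v = v1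
    · obtain ⟨rfl, rfl, rfl⟩ := h2
      rw [dg_ne _ u, comp_zero]
      rintro ⟨-, h3, h4⟩
      exact h1 ⟨rfl, h3, h4⟩
    · rw [dg_ne _ _ _ _ _ h2, zero_comp]

theorem DD_add (hF : ∀ p, p ∉ F → Subsingleton (M p)) (s t : Bool)
    (φ ψ : ∀ (v : Idx m) (n n' : ℤ), M (s, n, v) ⟶ M (t, n', v)) :
    DD M F s t φ + DD M F s t ψ = DD M F s t (fun v n n' => φ v n n' + ψ v n n') := by
  apply cmp_ext F hF
  rintro ⟨s1, n, v⟩ ⟨u1, n', v'⟩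
  rw [cmp_add]
  simp only [DD, cmp_mkE F hF]
  by_cases h1 : s1 = s ∧ u1 = t ∧ v = v'
  · obtain ⟨rfl, rfl, rfl⟩ := h1
    rw [dg_self, dg_self, dg_self]
  · rw [dg_ne _ _ _ _ _ h1, dg_ne _ _ _ _ _ h1, dg_ne _ _ _ _ _ h1, add_zero]

theorem DD_sub (hF : ∀ p, p ∉ F → Subsingleton (M p)) (s t : Bool)
    (φ ψ : ∀ (v : Idx m) (n n' : ℤ), M (s, n, v) ⟶ M (t, n', v)) :
    DD M F s t φ - DD M F s t ψ = DD M F s t (fun v n n' => φ v n n' - ψ v n n') := by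
  rw [sub_eq_iff_eq_add, DD_add F hF]
  congr 1
  funext v n n'
  abel

theorem DD_zero (hF : ∀ p, p ∉ F → Subsingleton (M p)) (s t : Bool)
    (φ : ∀ (v : Idx m) (n n' : ℤ), M (s, n, v) ⟶ M (t, n', v)) (h : ∀ v n n', φ v n n' = 0) :
    DD M F s t φ = 0 := by
  apply cmp_ext F hF
  rintro ⟨s1, n, v⟩ ⟨u1, n', v'⟩
  rw [cmp_zero]
  simp only [DD, cmp_mkE F hF]
  by_cases h1 : s1 = s ∧ u1 = t ∧ v = v'
  · obtain ⟨rfl, rfl, rfl⟩ := h1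
    rw [dg_self, h]
  · rw [dg_ne _ _ _ _ _ h1]

end DDsec

end Graded

/-! ### Chain-level families -/

section Fam

variable {R : Type} [CommRing R]

/-- The family of components of a chain map. -/
def cf {K L : CochainComplex (ModuleCat.{0} R) ℤ} (f : K ⟶ L) (n n' : ℤ) : K.X n ⟶ L.X n' :=
  if h : n = n' then f.f n ≫ eqToHom (congrArg L.X h) else 0

theorem cf_self {K L : CochainComplex (ModuleCat.{0} R) ℤ} (f : K ⟶ L) (n : ℤ) :
    cf f n n = f.f n := by simp [cf]

theorem cf_ne {K L : CochainComplex (ModuleCat.{0} R) ℤ} (f : K ⟶ L) (n n' : ℤ)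
    (h : n' ≠ n) : cf f n n' = 0 := by rw [cf, dif_neg (Ne.symm h)]

theorem d_ne {K : CochainComplex (ModuleCat.{0} R) ℤ} (n n' : ℤ)
    (h : n' ≠ n + 1) : K.d n n' = 0 := K.shape _ _ (by simpa using Ne.symm h)

theorem cf_comm {K L : CochainComplex (ModuleCat.{0} R) ℤ} (f : K ⟶ L) (n n' : ℤ) :
    K.d n (n + 1) ≫ cf f (n + 1) n' = cf f n n ≫ L.d n n' := by
  by_cases h : n' = n + 1
  · subst h
    rw [cf_self, cf_self, f.comm]
  · rw [cf_ne _ _ _ h, d_ne _ _ h, comp_zero, comp_zero]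

theorem cf_homotopy {K L : CochainComplex (ModuleCat.{0} R) ℤ} (f : K ⟶ L) (g : L ⟶ K)
    (H : Homotopy (f ≫ g) (𝟙 K)) (n n' : ℤ) :
    cf f n n ≫ cf g n n' - cf (𝟙 K) n n' =
      H.hom n (n - 1) ≫ K.d (n - 1) n' + K.d n (n + 1) ≫ H.hom (n + 1) n' := by
  by_cases h : n' = n
  · subst h
    have := H.comm n'
    rw [dNext_eq (i := n') (i' := n' + 1) H.hom (by simp),
      prevD_eq (j := n') (j' := n' - 1) H.hom (by simp)] at this
    rw [cf_self, cf_self, cf_self, ← HomologicalComplex.comp_f, this]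
    abel
  · rw [cf_ne _ _ _ h, cf_ne _ _ _ h, d_ne (n - 1) n' (by omega), H.zero (n + 1) n' (by
      simp only [ComplexShape.up_Rel]; omega)]
    simp

end Fam

section Core

variable {m : ℕ} {R : Type} [CommRing R]

/-- The family of modules. -/
abbrev MM (K : Bool → Idx m → CochainComplex (ModuleCat.{0} R) ℤ) :
    Bool × ℤ × Idx m → ModuleCat.{0} R := fun p => (K p.1 p.2.2).X p.2.1

variable (K : Bool → Idx m → CochainComplex (ModuleCat.{0} R) ℤ)
  (F : Finset (Bool × ℤ × Idx m))

/-- The projection onto one of the two parts. -/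
def ee (s : Bool) : Module.End R (Tot (MM K)) :=
  DD (MM K) F s s (fun v n n' => cf (𝟙 (K s v)) n n')

/-- The diagonal differential. -/
def dd (s : Bool) : Module.End R (Tot (MM K)) :=
  DD (MM K) F s s (fun v n n' => (K s v).d n n')

theorem ee_self (hF : ∀ p, p ∉ F → Subsingleton (MM K p))
    (s : Bool) (n : ℤ) (v : Idx m) :
    cmp (ee K F s) (s, n, v) (s, n, v) = 𝟙 _ := by
  rw [ee, DD, cmp_mkE F hF, dg_self, cf_self]; rfl

theorem ee_ne (hF : ∀ p, p ∉ F → Subsingleton (MM K p))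
    (s : Bool) (p q : Bool × ℤ × Idx m) (h : ¬ (p.1 = s ∧ p = q)) :
    cmp (ee K F s) p q = 0 := by
  rw [ee, DD, cmp_mkE F hF]
  obtain ⟨s1, n, v⟩ := p
  obtain ⟨t1, n', v'⟩ := q
  by_cases h1 : s1 = s ∧ t1 = s ∧ v = v'
  · obtain ⟨rfl, rfl, rfl⟩ := h1
    rw [dg_self, cf_ne]
    rintro rfl
    exact h ⟨rfl, rfl⟩
  · exact dg_ne _ _ _ _ _ h1

theorem ee_mem (hF : ∀ p, p ∉ F → Subsingleton (MM K p))
    (s : Bool) : ee K F s ∈ G (MM K) s s 0 0 :=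
  DD_mem F hF _ _ _ _ (fun v n n' h => cf_ne _ _ _ (by simpa using h))

theorem dd_mem (hF : ∀ p, p ∉ F → Subsingleton (MM K p))
    (s : Bool) : dd K F s ∈ G (MM K) s s 1 0 :=
  DD_mem F hF _ _ _ _ (fun v n n' h => d_ne _ _ h)

theorem mul_ee (hF : ∀ p, p ∉ F → Subsingleton (MM K p))
    {s t : Bool} {k j : ℤ} {a : Module.End R (Tot (MM K))}
    (ha : a ∈ G (MM K) s t k j) : a * ee K F s = a := by
  apply cmp_ext F hF
  rintro ⟨s1, n, v⟩ q
  rw [cmp_mul F hF]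
  by_cases h : s1 = s
  · subst h
    rw [finsum_eq_single _ (s1, n, v), ee_self K F hF, Category.id_comp]
    intro r hr
    rw [ee_ne K F hF, zero_comp]
    rintro ⟨-, h⟩
    exact hr h.symm
  · rw [ha _ q (fun h1 => h h1.1)]
    apply finsum_eq_zero_of_forall_eq_zero
    intro r
    rw [ee_ne K F hF, zero_comp]
    rintro ⟨h1, -⟩
    exact h h1

theorem ee_mul (hF : ∀ p, p ∉ F → Subsingleton (MM K p))
    {s t : Bool} {k j : ℤ} {a : Module.End R (Tot (MM K))}
    (ha : a ∈ G (MM K) s t k j) : ee K F t * a = a := by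
  apply cmp_ext F hF
  rintro p ⟨s1, n, v⟩
  rw [cmp_mul F hF]
  by_cases h : s1 = t
  · subst h
    rw [finsum_eq_single _ (s1, n, v), ee_self K F hF, Category.comp_id]
    intro r hr
    rw [ee_ne K F hF, comp_zero]
    rintro ⟨-, h⟩
    exact hr h
  · rw [ha p _ (fun h1 => h h1.2.1)]
    apply finsum_eq_zero_of_forall_eq_zero
    intro r
    rw [ee_ne K F hF, comp_zero]
    rintro ⟨h1, h2⟩
    rw [h2] at h1
    exact h h1

theorem dd_sq (hF : ∀ p, p ∉ F → Subsingleton (MM K p))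
    (s : Bool) : dd K F s * dd K F s = 0 := by
  rw [dd, DD_mul F hF _ _ _ _ _ (fun n => n + 1) (fun v n n' h => d_ne _ _ h)]
  exact DD_zero F hF _ _ _ (fun v n n' => (K s v).d_comp_d _ _ _)

theorem cf_rel (hF : ∀ p, p ∉ F → Subsingleton (MM K p))
    (s t : Bool) (f : ∀ v, K s v ⟶ K t v) :
    DD (MM K) F s t (fun v n n' => cf (f v) n n') * dd K F s =
      dd K F t * DD (MM K) F s t (fun v n n' => cf (f v) n n') := by
  rw [dd, dd, DD_mul F hF _ _ _ _ _ (fun n => n + 1) (fun v n n' h => d_ne _ _ h),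
    DD_mul F hF _ _ _ _ _ (fun n => n) (fun v n n' h => cf_ne _ _ _ h)]
  congr 1
  funext v n n'
  exact cf_comm (f v) n n'

theorem hty_rel (hF : ∀ p, p ∉ F → Subsingleton (MM K p))
    (s t : Bool) (f : ∀ v, K s v ⟶ K t v) (g : ∀ v, K t v ⟶ K s v)
    (H : ∀ v, Homotopy (f v ≫ g v) (𝟙 (K s v))) :
    DD (MM K) F t s (fun v n n' => cf (g v) n n') * DD (MM K) F s t (fun v n n' => cf (f v) n n')
      - ee K F s = dd K F s * DD (MM K) F s s (fun v n n' => (H v).hom n n') +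
        DD (MM K) F s s (fun v n n' => (H v).hom n n') * dd K F s := by
  rw [dd, ee, DD_mul F hF _ _ _ _ _ (fun n => n) (fun v n n' h => cf_ne _ _ _ h),
    DD_mul F hF _ _ _ _ _ (fun n => n - 1) (fun v n n' h => (H v).zero _ _ (by
      simp only [ComplexShape.up_Rel]; omega)),
    DD_mul F hF _ _ _ _ _ (fun n => n + 1) (fun v n n' h => d_ne _ _ h),
    DD_sub F hF, DD_add F hF]
  congr 1
  funext v n n'
  exact cf_homotopy (f v) (g v) (H v) n n'

theorem core (hF : ∀ p, p ∉ F → Subsingleton (MM K p))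
    (E : ∀ v, HomotopyEquiv (K false v) (K true v)) (d : Module.End R (Tot (MM K)))
    (hd : d ∈ G (MM K) true true 1 0) (hdd : d * d = 0)
    (hdiag : ∀ n v, cmp d (true, n, v) (true, n + 1, v) = (K true v).d n (n + 1)) :
    ∃ b f g H L : Module.End R (Tot (MM K)),
      b ∈ G (MM K) false false 1 0 ∧ f ∈ G (MM K) true false 0 0 ∧ g ∈ G (MM K) false true 0 0 ∧
      H ∈ G (MM K) true true (-1) 0 ∧ L ∈ G (MM K) false false (-1) 0 ∧
      b * b = 0 ∧ f * d = b * f ∧ d * g = g * b ∧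
      g * f - ee K F true = d * H + H * d ∧ f * g - ee K F false = b * L + L * b ∧
      ∀ n v, cmp b (false, n, v) (false, n + 1, v) = (K false v).d n (n + 1) := by
  set f0 := DD (MM K) F true false (fun v n n' => cf ((E v).inv) n n') with hf0
  set g0 := DD (MM K) F false true (fun v n n' => cf ((E v).hom) n n') with hg0
  set h := DD (MM K) F true true (fun v n n' => (E v).homotopyInvHomId.hom n n') with hh
  set k := DD (MM K) F false false (fun v n n' => (E v).homotopyHomInvId.hom n n') with hk
  set d0 := dd K F true with hd0
  set b0 := dd K F false with hb0
  have f0m : f0 ∈ G (MM K) true false 0 0 :=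
    DD_mem F hF _ _ _ _ (fun v n n' h => cf_ne _ _ _ (by simpa using h))
  have g0m : g0 ∈ G (MM K) false true 0 0 :=
    DD_mem F hF _ _ _ _ (fun v n n' h => cf_ne _ _ _ (by simpa using h))
  have hm : h ∈ G (MM K) true true (-1) 0 :=
    DD_mem F hF _ _ _ _ (fun v n n' h => Homotopy.zero _ _ _ (by
      simp only [ComplexShape.up_Rel]; omega))
  have km : k ∈ G (MM K) false false (-1) 0 :=
    DD_mem F hF _ _ _ _ (fun v n n' h => Homotopy.zero _ _ _ (by
      simp only [ComplexShape.up_Rel]; omega))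
  have d0m : d0 ∈ G (MM K) true true 1 0 := dd_mem K F hF true
  have b0m : b0 ∈ G (MM K) false false 1 0 := dd_mem K F hF false
  set δ := d - d0 with hδ
  have δm0 : δ ∈ G (MM K) true true 1 0 := sub_mem hd d0m
  have δm : δ ∈ G (MM K) true true 1 1 := by
    rintro ⟨s, n, v⟩ ⟨t, n', v'⟩ hok
    by_cases h1 : Ok true true 1 0 (s, n, v) (t, n', v')
    · obtain ⟨a1, a2, a3, a4, a5⟩ := h1
      simp only at a1 a2 a3 a4
      subst a1 a2 a3
      by_cases hv : v = v'
      · subst hv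
        rw [hδ, cmp_sub, hdiag, hd0, dd, DD, cmp_mkE F hF, dg_self, sub_self]
      · exfalso
        apply hok
        refine ⟨rfl, rfl, rfl, a4, ?_⟩
        have hlt : v < v' := lt_of_le_of_ne a4 hv
        obtain ⟨_, i, hi⟩ := Pi.lt_def.1 hlt
        have : tdeg v < tdeg v' := Finset.sum_lt_sum (fun i _ => a4 i) ⟨i, Finset.mem_univ _, hi⟩
        exact this
    · exact δm0 _ _ h1
  have hdδ : d = d0 + δ := by rw [hδ]; abel
  have δh : δ * h ∈ G (MM K) true true 0 1 := G_mul F hF δm hm (by norm_num) (by norm_num)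
  obtain ⟨P, Pm, hP1, hP2⟩ := G_inv F hF δh
  have d0sq : d0 * d0 = 0 := dd_sq K F hF true
  have hmc : d0 * δ + δ * d0 + δ * δ = 0 := by
    have h1 := hdd
    rw [hdδ] at h1
    linear_combination (norm := noncomm_ring) h1 - d0sq
  obtain ⟨r1, r2, r3, r4⟩ := pert_ring d0 δ h f0 g0 b0 (ee K F true) (1 + P) hP1 hP2 hmc
    (dd_sq K F hF false) (cf_rel K F hF true false (fun v => (E v).inv))
    (cf_rel K F hF false true (fun v => (E v).hom)).symm
    (hty_rel K F hF true false (fun v => (E v).inv) (fun v => (E v).hom)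
      (fun v => (E v).homotopyInvHomId)) (ee_mul K F hF δm) (mul_ee K F hF δm)
  have hty2 := hty_rel K F hF false true (fun v => (E v).hom) (fun v => (E v).inv)
      (fun v => (E v).homotopyHomInvId)
  rw [← hf0, ← hg0, ← hk, ← hb0] at hty2
  rw [← hdδ] at r2 r3 r4
  -- the pieces of positive filtration degree
  have fP : f0 * P ∈ G (MM K) true false 0 1 := G_mul F hF f0m Pm (by norm_num) (by norm_num)
  have f1 : f0 * (1 + P) = f0 + f0 * P := by noncomm_ring
  have fm : f0 * (1 + P) ∈ G (MM K) true false 0 0 := by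
    rw [f1]; exact add_mem f0m (G_mono (by norm_num) fP)
  have δg : δ * g0 ∈ G (MM K) false true 1 1 := G_mul F hF δm g0m (by norm_num) (by norm_num)
  have b1 : f0 * (1 + P) * δ * g0 ∈ G (MM K) false false 1 1 := by
    rw [mul_assoc]
    exact G_mul F hF fm δg (by norm_num) (by norm_num)
  have hU : h * (1 + P) = h + h * P := by noncomm_ring
  have Hm : h * (1 + P) ∈ G (MM K) true true (-1) 0 := by
    rw [hU]
    exact add_mem hm (G_mul F hF hm Pm (by norm_num) (by norm_num))
  have g1 : h * (1 + P) * δ * g0 ∈ G (MM K) false true 0 1 := by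
    rw [mul_assoc]
    exact G_mul F hF Hm δg (by norm_num) (by norm_num)
  set b' := f0 * (1 + P) * δ * g0 with hb'
  set g' := h * (1 + P) * δ * g0 with hg'
  set H := h * (1 + P) with hH
  have gm : g0 + g' ∈ G (MM K) false true 0 0 := add_mem g0m (G_mono (by norm_num) g1)
  have bm : b0 + b' ∈ G (MM K) false false 1 0 := add_mem b0m (G_mono (by norm_num) b1)
  set N := f0 * (1 + P) * (g0 + g') - ee K F false - ((b0 + b') * k + k * (b0 + b')) with hN
  have Nm : N ∈ G (MM K) false false 0 1 := by
    have h1 : N = f0 * g' + (f0 * P) * (g0 + g') - b' * k - k * b' := by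
      rw [hN]
      linear_combination (norm := noncomm_ring) hty2
    rw [h1]
    refine sub_mem (sub_mem (add_mem ?_ ?_) ?_) ?_
    · exact G_mul F hF f0m g1 (by norm_num) (by norm_num)
    · exact G_mul F hF fP gm (by norm_num) (by norm_num)
    · exact G_mul F hF b1 km (by norm_num) (by norm_num)
    · exact G_mul F hF km b1 (by norm_num) (by norm_num)
  obtain ⟨Q, Qm, hQ1, hQ2⟩ := G_inv F hF (neg_mem Nm)
  rw [sub_neg_eq_add] at hQ1 hQ2
  set f := f0 * (1 + P) with hf
  set g := g0 + g' with hg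
  set b := b0 + b' with hb
  set W := f * H * g - f * g * k - k * f * g + k * (b * k + k * b) + k with hW
  have r5 := pert_ring2 d b f g H k (ee K F false) Q r2 r3 r1 (ee_mul K F hF bm)
    (mul_ee K F hF bm) (mul_ee K F hF (ee_mem K F hF false)) (ee_mul K F hF fm)
    (mul_ee K F hF gm) (ee_mul K F hF km) (mul_ee K F hF km) (ee K F true)
    (mul_ee K F hF fm) r4 N hN hQ1 hQ2 (k + (1 + Q) * W) rfl
  have fgm : f * g ∈ G (MM K) false false 0 0 := G_mul F hF fm gm (by norm_num) (by norm_num)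
  have bkm : b * k + k * b ∈ G (MM K) false false 0 0 :=
    add_mem (G_mul F hF bm km (by norm_num) (by norm_num))
      (G_mul F hF km bm (by norm_num) (by norm_num))
  have Wm : W ∈ G (MM K) false false (-1) 0 := by
    rw [hW, mul_assoc k f g]
    refine add_mem (add_mem (sub_mem (sub_mem ?_ ?_) ?_) ?_) km
    · exact G_mul F hF (G_mul F hF fm Hm (k'' := -1) (j'' := 0) (by norm_num) (by norm_num)) gm
        (by norm_num) (by norm_num)
    · exact G_mul F hF fgm km (by norm_num) (by norm_num)
    · exact G_mul F hF km fgm (by norm_num) (by norm_num)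
    · exact G_mul F hF km bkm (by norm_num) (by norm_num)
  have Lm : k + (1 + Q) * W ∈ G (MM K) false false (-1) 0 := by
    have : k + (1 + Q) * W = k + (W + Q * W) := by noncomm_ring
    rw [this]
    exact add_mem km (add_mem Wm (G_mul F hF Qm Wm (by norm_num) (by norm_num)))
  refine ⟨b, f, g, H, k + (1 + Q) * W, bm, fm, gm, Hm, Lm, r1, r2, r3, r4, r5, ?_⟩
  intro n v
  rw [hb, cmp_add, b1 _ _ (fun h => by have := h.2.2.2.2; simp at this), add_zero, hb0, dd, DD,
    cmp_mkE F hF, dg_self]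

end Core

end CR

/-- **Statement 15** (Constituent replacement). Let `X` be a multi-filtered complex and for
each `v` let `B v` be a cochain complex with only finitely many nontrivial terms together
with a homotopy equivalence `B v ≃ X_v` (with `B v = 0` whenever `X_v = 0`). Then there is
a multi-filtered complex `Y` whose objects are those of the complexes `B v`, whose diagonal
differential components are the differentials of the `B v`, and which is filtered homotopy
equivalent to `X`. -/
theorem constituent_replacement {m : ℕ} {R : Type} [CommRing R] (X : MFC m R)
    (B : Idx m → CochainComplex (ModuleCat.{0} R) ℤ)
    (hfin : {p : ℤ × Idx m | ¬ Subsingleton ((B p.2).X p.1)}.Finite)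
    (hB : ∀ v : Idx m, Nonempty (HomotopyEquiv (B v) (constituent X v))) :
    ∃ (Y : MFC m R) (hX : ∀ (n : ℤ) (v : Idx m), Y.X n v = (B v).X n),
      (∀ (n : ℤ) (v : Idx m),
        Y.d n v v = eqToHom (hX n v) ≫ (B v).d n (n + 1) ≫ eqToHom (hX (n + 1) v).symm) ∧
      Nonempty (MFCHomotopyEquiv X Y) := by
  classical
  have E : ∀ v, HomotopyEquiv (B v) (constituent X v) := fun v => (hB v).some
  let K : Bool → Idx m → CochainComplex (ModuleCat.{0} R) ℤ := fun s v =>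
    match s with
    | true => constituent X v
    | false => B v
  let F : Finset (Bool × ℤ × Idx m) := Finset.univ ×ˢ (X.fin.toFinset ∪ hfin.toFinset)
  have hF : ∀ p, p ∉ F → Subsingleton (CR.MM K p) := by
    rintro ⟨s, n, v⟩ hp
    have h1 : ¬ (¬ Subsingleton (X.X n v) ∨ ¬ Subsingleton ((B v).X n)) := by
      intro h
      apply hp
      simpa [F] using h
    push Not at h1
    cases s
    · exact h1.2
    · exact h1.1
  let dX : ∀ p q, CR.MM K p ⟶ CR.MM K q := fun p q =>
    match p, q with
    | (true, n, v), (true, n', v') =>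
      if h : n + 1 = n' then (X.d n v v' : X.X n v ⟶ X.X (n + 1) v') ≫
        eqToHom (congrArg (fun i => X.X i v') h) else 0
    | (true, _, _), (false, _, _) => 0
    | (false, _, _), (true, _, _) => 0
    | (false, _, _), (false, _, _) => 0
  have hdX : ∀ n v v', dX (true, n, v) (true, n + 1, v') = X.d n v v' := by
    intro n v v'
    simp only [dX, dif_pos, eqToHom_refl]
    exact Category.comp_id _
  let d : Module.End R (CR.Tot (CR.MM K)) := CR.mkE F dX
  have hdc : ∀ n v v', CR.cmp d (true, n, v) (true, n + 1, v') = X.d n v v' := by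
    intro n v v'
    rw [CR.cmp_mkE F hF, hdX]
  have hd : d ∈ CR.G (CR.MM K) true true 1 0 := by
    rintro ⟨s, n, v⟩ ⟨t, n', v'⟩ hok
    rw [CR.cmp_mkE F hF]
    cases s <;> cases t <;> try rfl
    by_cases h : n + 1 = n'
    · subst h
      rw [hdX]
      apply X.d_supp
      intro hle
      refine hok ⟨rfl, rfl, rfl, hle, ?_⟩
      rw [add_zero]
      exact Finset.sum_le_sum (fun i _ => hle i)
    · exact dif_neg h
  have hdd : d * d = 0 := by
    apply CR.cmp_ext F hF
    rintro ⟨s, n, v⟩ ⟨t, n', v'⟩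
    rw [CR.cmp_zero]
    have h2 : d * d ∈ CR.G (CR.MM K) true true 2 0 :=
      CR.G_mul F hF hd hd (by norm_num) (by norm_num)
    by_cases hok : CR.Ok true true 2 0 (s, n, v) (t, n', v')
    · obtain ⟨a1, a2, a3, -, -⟩ := hok
      simp only at a1 a2 a3
      have a4 : n' = n + 1 + 1 := by omega
      subst a1 a2 a4
      rw [CR.cmp_mul_G F hF hd n (n + 1) rfl]
      simp only [hdc]
      exact X.dsq n v v'
    · exact h2 _ _ hok
  obtain ⟨b, f, g, H, L, bm, fm, gm, Hm, Lm, r1, r2, r3, r4, r5, hbd⟩ :=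
    CR.core K F hF E d hd hdd (by
      intro n v
      rw [hdc]
      exact (CochainComplex.of_d (fun n => X.X n v) (fun n => X.d n v v) n).symm)
  let Y : MFC m R :=
    { X := fun n v => (B v).X n
      d := fun n v v' => CR.cmp b (false, n, v) (false, n + 1, v')
      d_supp := fun n v v' h => bm _ _ (fun hok => h hok.2.2.2.1)
      fin := hfin
      dsq := fun n v v'' => by
        have := CR.cmp_mul_G F hF (b := b) bm n (n + 1) rfl v (false, n + 1 + 1, v'')
        rw [r1, CR.cmp_zero] at this
        exact this.symm }
  have hid : ∀ (s : Bool) n v v'', CR.cmp (CR.ee K F s) (s, n, v) (s, n, v'') =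
      if h : v = v'' then eqToHom (by rw [h]) else 0 := by
    intro s n v v''
    split_ifs with h
    · subst h
      rw [CR.ee_self K F hF, eqToHom_refl]
    · rw [CR.ee_ne K F hF]
      rintro ⟨-, h2⟩
      apply h
      simpa using h2
  have castL : ∀ (s : Bool) (n n' : ℤ) (hn : n = n') (v : Idx m) (q : Bool × ℤ × Idx m)
      (a : Module.End R (CR.Tot (CR.MM K))),
      eqToHom (by rw [hn]) ≫ CR.cmp a (s, n', v) q = CR.cmp a (s, n, v) q := by
    intro s n n' hn v q a
    subst hn
    simp
  have castR : ∀ (s : Bool) (n n' : ℤ) (hn : n' = n) (v : Idx m) (p : Bool × ℤ × Idx m)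
      (a : Module.End R (CR.Tot (CR.MM K))),
      CR.cmp a p (s, n', v) ≫ eqToHom (by rw [hn]) = CR.cmp a p (s, n, v) := by
    intro s n n' hn v q a
    subst hn
    simp
  have hmt : ∀ (s t : Bool) (dd a c u w : Module.End R (CR.Tot (CR.MM K)))
      (_ : a ∈ CR.G (CR.MM K) s t 0 0) (_ : dd ∈ CR.G (CR.MM K) s s 1 0)
      (_ : u ∈ CR.G (CR.MM K) s s (-1) 0)
      (_ : c * a - CR.ee K F s = dd * u + u * dd) (n : ℤ) (v v'' : Idx m),
      (∑ᶠ v', CR.cmp a (s, n, v) (t, n, v') ≫ CR.cmp c (t, n, v') (s, n, v''))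
        - (if h : v = v'' then eqToHom (by rw [h]) else 0) =
      (∑ᶠ v', (eqToHom (by rw [Int.sub_add_cancel]) ≫
          CR.cmp u (s, n - 1 + 1, v) (s, n - 1, v')) ≫
          CR.cmp dd (s, n - 1, v') (s, n - 1 + 1, v'') ≫ eqToHom (by rw [Int.sub_add_cancel]))
        + ∑ᶠ v', CR.cmp dd (s, n, v) (s, n + 1, v') ≫ CR.cmp u (s, n + 1, v') (s, n, v'') := by
    intro s t dd a c u w ha hdd' hu hrel n v v''
    have h1 := congrArg (fun x => CR.cmp x (s, n, v) (s, n, v'')) hrel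
    simp only [CR.cmp_sub, CR.cmp_add] at h1
    rw [CR.cmp_mul_G F hF ha n n (by simp), CR.cmp_mul_G F hF hu n (n - 1) rfl,
      CR.cmp_mul_G F hF hdd' n (n + 1) rfl, hid] at h1
    rw [h1]
    congr 1
    refine finsum_congr fun v' => ?_
    rw [castL s n (n - 1 + 1) (by omega), castR s n (n - 1 + 1) (by omega)]
  refine ⟨Y, fun n v => rfl, ?_, ⟨?_⟩⟩
  · intro n v
    rw [eqToHom_refl, eqToHom_refl, Category.comp_id, Category.id_comp]
    exact hbd n v
  · exact
    { toFun :=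
        { f := fun n v v' => CR.cmp f (true, n, v) (false, n, v')
          supp := fun n v v' h => fm _ _ (fun hok => h hok.2.2.2.1)
          comm := fun n v v'' => by
            have h1 := congrArg (fun x => CR.cmp x (true, n, v) (false, n + 1, v'')) r2
            beta_reduce at h1
            rw [CR.cmp_mul_G F hF hd n (n + 1) rfl, CR.cmp_mul_G F hF fm n n (by simp)] at h1
            simp only [hdc] at h1
            exact h1 }
      invFun :=
        { f := fun n v v' => CR.cmp g (false, n, v) (true, n, v')
          supp := fun n v v' h => gm _ _ (fun hok => h hok.2.2.2.1)
          comm := fun n v v'' => by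
            have h1 := congrArg (fun x => CR.cmp x (false, n, v) (true, n + 1, v'')) r3
            beta_reduce at h1
            rw [CR.cmp_mul_G F hF bm n (n + 1) rfl, CR.cmp_mul_G F hF gm n n (by simp)] at h1
            simp only [hdc] at h1
            exact h1.symm }
      hC := fun n v v' => CR.cmp H (true, n + 1, v) (true, n, v')
      hC_supp := fun n v v' h => Hm _ _ (fun hok => h hok.2.2.2.1)
      hD := fun n v v' => CR.cmp L (false, n + 1, v) (false, n, v')
      hD_supp := fun n v v' h => Lm _ _ (fun hok => h hok.2.2.2.1)
      homC := fun n v v'' => by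
        have h1 := hmt true false d f g H 0 fm hd Hm r4 n v v''
        simp only [hdc] at h1
        exact h1
      homD := fun n v v'' => hmt false true b g f L 0 gm bm Lm r5 n v v'' }
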